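/- (Optimality Claim, part 1) The Liveness Theorem fails if d_open is replaced by a smaller constant: for all positive reals d_min, d_max, d_open, d_close with d_close < d_min ≤ d_max, and for every constant c with 0 < c < d_open, there exist a regular run with a single track and reals α, β with 0 ≤ α and α + c < β − D_close such that TrackStatus(x,t) ≠ incrossing for the track x and all t ∈ (α,β), yet GateStatus(t) ≠ opened for some t ∈ [α + c, β − D_close]. -/

import Mathlib

namespace RailCross

inductive TStat : Type
  | emp | coming | incrossing
deriving DecidableEq

inductive DirV : Type
  | opn | cls
deriving DecidableEq

inductive GateV : Type
  | opened | closed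
deriving DecidableEq

/-- `f` is piecewise constant on `[0, ∞)`: for every `τ > 0` there is a finite
partition `0 = s 0 < s 1 < … < s n = τ` such that `f` is constant on each open
subinterval `(s i, s (i+1))`. -/
def PWC {Y : Type*} (f : ℝ → Y) : Prop :=
  ∀ τ : ℝ, 0 < τ → ∃ n : ℕ, ∃ s : ℕ → ℝ,
    s 0 = 0 ∧ s n = τ ∧ (∀ i < n, s i < s (i + 1)) ∧
    (∀ i < n, ∀ a b : ℝ, s i < a → a < b → b < s (i + 1) → f a = f b)

/-- `v` is the right-hand value `f(t+)`: `f` is constantly `v` on some `(t, t+ε)`. -/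
def RightVal {Y : Type*} (f : ℝ → Y) (t : ℝ) (v : Y) : Prop :=
  ∃ ε : ℝ, 0 < ε ∧ ∀ u : ℝ, t < u → u < t + ε → f u = v

/-- `v` is the left-hand value `f(t−)` (for `t > 0`): `f` is constantly `v` on some `(t-ε, t)`. -/
def LeftVal {Y : Type*} (f : ℝ → Y) (t : ℝ) (v : Y) : Prop :=
  ∃ ε : ℝ, 0 < ε ∧ ε ≤ t ∧ ∀ u : ℝ, t - ε < u → u < t → f u = v

/-- `tm` is the (finite or infinite) increasing sequence of significant moments of a
track with status function `f`; a finite sequence is encoded by letting `tm` take the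
value `⊤ = ∞` from some point on. -/
structure TrainMotion (dmin dmax : ℝ) (f : ℝ → TStat) (tm : ℕ → EReal) : Prop where
  zero : tm 0 = 0
  mono : Monotone tm
  strict : ∀ i, tm i ≠ ⊤ → tm i < tm (i + 1)
  last_div : ∀ k, tm k ≠ ⊤ → tm (k + 1) = ⊤ → 3 ∣ k
  status_empty : ∀ i : ℕ, ∀ u : ℝ, tm (3 * i) ≤ (u : EReal) → (u : EReal) < tm (3 * i + 1) →
    f u = TStat.emp
  status_coming : ∀ i : ℕ, ∀ u : ℝ, tm (3 * i + 1) ≤ (u : EReal) → (u : EReal) < tm (3 * i + 2) →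
    f u = TStat.coming
  status_cross : ∀ i : ℕ, ∀ u : ℝ, tm (3 * i + 2) ≤ (u : EReal) → (u : EReal) < tm (3 * i + 3) →
    f u = TStat.incrossing
  gap : ∀ i : ℕ, ∀ a b : ℝ, tm (3 * i + 1) = (a : EReal) → tm (3 * i + 2) = (b : EReal) →
    dmin ≤ b - a ∧ b - a ≤ dmax

/-- `SafeToOpen(t)`: every track is empty or its deadline is more than `dopen` away. -/
def SafeToOpen {Tracks : Type*} (dopen : ℝ) (trackStatus : Tracks → ℝ → TStat)
    (deadline : Tracks → ℝ → EReal) (t : ℝ) : Prop :=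
  ∀ x : Tracks, trackStatus x t = TStat.emp ∨ ((t + dopen : ℝ) : EReal) < deadline x t

/-- A regular run of the railroad-crossing evolving algebra.  `WaitTime = dmin - dclose`. -/
structure RegularRun (Tracks : Type*) (dmin dmax dopen dclose : ℝ) where
  trackStatus : Tracks → ℝ → TStat
  deadline : Tracks → ℝ → EReal
  dir : ℝ → DirV
  gate : ℝ → GateV
  /-- the right-hand value `Deadline(x, t+)` -/
  deadlinePlus : Tracks → ℝ → EReal
  /-- the right-hand value `Dir(t+)` -/
  dirPlus : ℝ → DirV
  /-- the right-hand value `GateStatus(t+)` -/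
  gatePlus : ℝ → GateV
  pwc_ts : ∀ x, PWC (trackStatus x)
  pwc_dl : ∀ x, PWC (deadline x)
  pwc_dir : PWC dir
  pwc_gate : PWC gate
  dlPlus_spec : ∀ x, ∀ t : ℝ, 0 ≤ t → RightVal (deadline x) t (deadlinePlus x t)
  dirPlus_spec : ∀ t : ℝ, 0 ≤ t → RightVal dir t (dirPlus t)
  gatePlus_spec : ∀ t : ℝ, 0 ≤ t → RightVal gate t (gatePlus t)
  dl_left : ∀ x, ∀ t : ℝ, 0 < t → LeftVal (deadline x) t (deadline x t)
  dir_left : ∀ t : ℝ, 0 < t → LeftVal dir t (dir t)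
  gate_left : ∀ t : ℝ, 0 < t → LeftVal gate t (gate t)
  trainMotion : ∀ x, ∃ tm : ℕ → EReal, TrainMotion dmin dmax (trackStatus x) tm
  dl_init : ∀ x, deadline x 0 = ⊤
  dir_init : dir 0 = DirV.opn
  gate_init : gate 0 = GateV.opened
  dl_step_coming : ∀ x, ∀ t : ℝ, 0 ≤ t → trackStatus x t = TStat.coming → deadline x t = ⊤ →
    deadlinePlus x t = ((t + (dmin - dclose) : ℝ) : EReal)
  dl_step_empty : ∀ x, ∀ t : ℝ, 0 ≤ t → trackStatus x t = TStat.emp → deadline x t ≠ ⊤ →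
    deadlinePlus x t = ⊤
  dl_step_other : ∀ x, ∀ t : ℝ, 0 ≤ t →
    ¬(trackStatus x t = TStat.coming ∧ deadline x t = ⊤) →
    ¬(trackStatus x t = TStat.emp ∧ deadline x t ≠ ⊤) →
    deadlinePlus x t = deadline x t
  dir_step_close : ∀ t : ℝ, 0 ≤ t → (∃ x, deadline x t = (t : EReal)) → dirPlus t = DirV.cls
  dir_step_open : ∀ t : ℝ, 0 ≤ t → (∀ x, deadline x t ≠ (t : EReal)) → dir t = DirV.cls →
    SafeToOpen dopen trackStatus deadline t → dirPlus t = DirV.opn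
  dir_step_other : ∀ t : ℝ, 0 ≤ t → (∀ x, deadline x t ≠ (t : EReal)) →
    ¬(dir t = DirV.cls ∧ SafeToOpen dopen trackStatus deadline t) → dirPlus t = dir t
  gate_step : ∀ t : ℝ, 0 ≤ t →
    gatePlus t = gate t ∨ (dir t = DirV.opn ∧ gatePlus t = GateV.opened) ∨
      (dir t = DirV.cls ∧ gatePlus t = GateV.closed)
  gate_close_bound : ∀ t : ℝ, 0 ≤ t →
    ¬(∀ u ∈ Set.Ioo t (t + dclose), dir u = DirV.cls ∧ gate u = GateV.opened)
  gate_open_bound : ∀ t : ℝ, 0 ≤ t →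
    ¬(∀ u ∈ Set.Ioo t (t + dopen), dir u = DirV.opn ∧ gate u = GateV.closed)

/-- The left-continuous function with value `p` on `(a, b]` and `q` elsewhere. -/
noncomputable def pulse {Y : Type*} (a b : ℝ) (p q : Y) (t : ℝ) : Y :=
  if a < t ∧ t ≤ b then p else q

/-- The right-hand values of `pulse a b p q`. -/
noncomputable def pulsePlus {Y : Type*} (a b : ℝ) (p q : Y) (t : ℝ) : Y :=
  if a ≤ t ∧ t < b then p else q

theorem pwc_const {Y : Type*} (v : Y) : PWC (fun _ : ℝ => v) := by
  intro τ hτ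
  refine ⟨1, fun i => i * τ, by simp, by simp, ?_, fun _ _ _ _ _ _ _ => rfl⟩
  intro i _
  push_cast
  linarith

theorem PWC.of_eq_of_lt {Y : Type*} {f g : ℝ → Y} (hf : PWC f) {a : ℝ} (ha : 0 < a) {v : Y}
    (hlt : ∀ t, t < a → g t = f t) (hgt : ∀ t, a < t → g t = v) : PWC g := by
  have key : ∀ (n : ℕ) (s : ℕ → ℝ), (∀ i < n, s i < s (i + 1)) → ∀ i, i ≤ n → s i ≤ s n := by
    intro n s hs i hi
    induction n with
    | zero => simp_all
    | succ n ih =>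
      rcases Nat.lt_or_ge n i with h | h
      · have : i = n + 1 := by omega
        rw [this]
      · exact (ih (fun j hj => hs j (by omega)) h).trans (hs n (by omega)).le
  intro τ hτ
  rcases le_or_gt τ a with hτa | hτa
  · obtain ⟨n, s, h0, hn, hs, hc⟩ := hf τ hτ
    refine ⟨n, s, h0, hn, hs, fun i hi x y hx hxy hy => ?_⟩
    have := key n s hs (i + 1) (by omega)
    rw [hlt x (by linarith), hlt y (by linarith)]
    exact hc i hi x y hx hxy hy
  · obtain ⟨n, s, h0, hn, hs, hc⟩ := hf a ha
    have hold : ∀ i, i ≤ n → (if i ≤ n then s i else τ) = s i := fun i hi => if_pos hi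
    have hnew : (if n + 1 ≤ n then s (n + 1) else τ) = τ := if_neg (by omega)
    refine ⟨n + 1, fun i => if i ≤ n then s i else τ, ?_, hnew, ?_, ?_⟩
    · simpa using h0
    · intro i hi
      rcases Nat.lt_or_ge i n with h | h
      · simpa only [hold i h.le, hold (i + 1) h] using hs i h
      · obtain rfl : i = n := by omega
        beta_reduce
        rw [hold i le_rfl, hnew, hn]
        exact hτa
    · intro i hi x y hx hxy hy
      rcases Nat.lt_or_ge i n with h | h
      · simp only [hold i h.le, hold (i + 1) h] at hx hy
        have := key n s hs (i + 1) h
        rw [hlt x (by linarith), hlt y (by linarith)]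
        exact hc i h x y hx hxy hy
      · obtain rfl : i = n := by omega
        beta_reduce at hx
        rw [hold i le_rfl, hn] at hx
        rw [hgt x hx, hgt y (hx.trans hxy)]

theorem pwc_pulse {Y : Type*} {a b : ℝ} (ha : 0 < a) (hab : a < b) (p q : Y) :
    PWC (pulse a b p q) := by
  have h : PWC (fun t : ℝ => if a < t then p else q) :=
    (pwc_const q).of_eq_of_lt ha (v := p) (fun t ht => if_neg ht.le.not_gt) fun t ht => if_pos ht
  refine h.of_eq_of_lt (ha.trans hab) (v := q) (fun t ht => ?_) fun t ht => ?_
  · simp [pulse, ht.le]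
  · simp [pulse, ht.not_ge]

theorem rightVal_pulse {Y : Type*} (a b : ℝ) (p q : Y) (t : ℝ) :
    RightVal (pulse a b p q) t (pulsePlus a b p q t) := by
  have key : ∀ d : ℝ, ∃ ε > 0, ∀ u, t < u → u < t + ε → (d < u ↔ d ≤ t) := by
    intro d
    rcases le_or_gt d t with h | h
    · exact ⟨1, one_pos, fun u hu _ => iff_of_true (h.trans_lt hu) h⟩
    · exact ⟨d - t, by linarith, fun u _ hu => iff_of_false (by linarith) h.not_ge⟩
  obtain ⟨ε, hε, h1⟩ := key a
  obtain ⟨δ, hδ, h2⟩ := key b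
  refine ⟨min ε δ, lt_min hε hδ, fun u hu hu' => ?_⟩
  have e1 := h1 u hu (by linarith [min_le_left ε δ])
  have e2 := h2 u hu (by linarith [min_le_right ε δ])
  simp only [pulse, pulsePlus, e1, ← not_lt, e2]
  simp only [not_lt, not_le]

theorem leftVal_pulse {Y : Type*} (a b : ℝ) (p q : Y) {t : ℝ} (ht : 0 < t) :
    LeftVal (pulse a b p q) t (pulse a b p q t) := by
  have key : ∀ d : ℝ, ∃ ε > 0, ∀ u, t - ε < u → u < t → (d < u ↔ d < t) := by
    intro d
    rcases lt_or_ge d t with h | h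
    · exact ⟨t - d, by linarith, fun u hu _ => iff_of_true (by linarith) h⟩
    · exact ⟨1, one_pos, fun u _ hu => iff_of_false (by linarith) h.not_gt⟩
  obtain ⟨ε, hε, h1⟩ := key a
  obtain ⟨δ, hδ, h2⟩ := key b
  refine ⟨min t (min ε δ), lt_min ht (lt_min hε hδ), min_le_left _ _, fun u hu hu' => ?_⟩
  have hm := min_le_right t (min ε δ)
  have e1 := h1 u (by linarith [min_le_left ε δ]) hu'
  have e2 := h2 u (by linarith [min_le_right ε δ]) hu'
  simp only [pulse, e1, ← not_lt, e2]

/-- The status of a track on which a single train comes at time `1`, reaches the crossing after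
`d` units of time and leaves it one unit of time later. -/
noncomputable def singleTrain (d t : ℝ) : TStat :=
  if t < 2 + d then if t < 1 + d then if t < 1 then .emp else .coming else .incrossing else .emp

theorem pwc_singleTrain {d : ℝ} (hd : 0 < d) : PWC (singleTrain d) := by
  have h1 : PWC (fun t : ℝ => if t < 1 then TStat.emp else .coming) :=
    (pwc_const TStat.emp).of_eq_of_lt one_pos (v := .coming) (fun t ht => if_pos ht)
      fun t ht => if_neg ht.not_gt
  have h2 : PWC (fun t : ℝ => if t < 1 + d then if t < 1 then TStat.emp else .coming
      else .incrossing) :=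
    h1.of_eq_of_lt (a := 1 + d) (by linarith) (v := .incrossing) (fun t ht => if_pos ht)
      fun t ht => if_neg ht.not_gt
  exact h2.of_eq_of_lt (a := 2 + d) (by linarith) (v := .emp) (fun t ht => if_pos ht)
    fun t ht => if_neg ht.not_gt

/-- The significant moments of `singleTrain d`. -/
noncomputable def singleTrainMoment (d : ℝ) : ℕ → EReal
  | 0 => ((0 : ℝ) : EReal)
  | 1 => ((1 : ℝ) : EReal)
  | 2 => ((1 + d : ℝ) : EReal)
  | 3 => ((2 + d : ℝ) : EReal)
  | _ + 4 => ⊤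

theorem singleTrainMoment_strict {d : ℝ} (hd : 0 < d) (i : ℕ) (hi : singleTrainMoment d i ≠ ⊤) :
    singleTrainMoment d i < singleTrainMoment d (i + 1) := by
  match i, hi with
  | 0, _ => exact EReal.coe_lt_coe_iff.2 one_pos
  | 1, _ => exact EReal.coe_lt_coe_iff.2 (by linarith)
  | 2, _ => exact EReal.coe_lt_coe_iff.2 (by linarith)
  | 3, _ => exact EReal.coe_lt_top _
  | _ + 4, hi => exact absurd rfl hi

theorem trainMotion_singleTrain {dmin dmax : ℝ} (hd : 0 < dmin) (h : dmin ≤ dmax) :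
    TrainMotion dmin dmax (singleTrain dmin) (singleTrainMoment dmin) where
  zero := rfl
  mono := by
    refine monotone_nat_of_le_succ fun i => ?_
    by_cases hi : singleTrainMoment dmin i = ⊤
    · match i, hi with
      | _ + 4, _ => exact le_rfl
    · exact (singleTrainMoment_strict hd i hi).le
  strict := singleTrainMoment_strict hd
  last_div := by
    intro k hk hk'
    match k, hk, hk' with
    | 0, _, hk' => exact absurd hk' (EReal.coe_ne_top _)
    | 1, _, hk' => exact absurd hk' (EReal.coe_ne_top _)
    | 2, _, hk' => exact absurd hk' (EReal.coe_ne_top _)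
    | 3, _, _ => exact dvd_rfl
    | _ + 4, hk, _ => exact absurd rfl hk
  status_empty := by
    intro i u h1 h2
    match i, h1, h2 with
    | 0, _, h2 =>
      have h2 : u < 1 := EReal.coe_lt_coe_iff.1 h2
      have h3 : u < 1 + dmin := by linarith
      simp [singleTrain, h2, h3]
    | 1, h1, _ =>
      have h1 : 2 + dmin ≤ u := EReal.coe_le_coe_iff.1 h1
      simp [singleTrain, h1.not_gt]
    | _ + 2, h1, _ => exact absurd (EReal.coe_lt_top u) h1.not_gt
  status_coming := by
    intro i u h1 h2
    match i, h1, h2 with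
    | 0, h1, h2 =>
      have h1 : 1 ≤ u := EReal.coe_le_coe_iff.1 h1
      have h2 : u < 1 + dmin := EReal.coe_lt_coe_iff.1 h2
      have h3 : u < 2 + dmin := by linarith
      simp [singleTrain, h1.not_gt, h2, h3]
    | _ + 1, h1, _ => exact absurd (EReal.coe_lt_top u) h1.not_gt
  status_cross := by
    intro i u h1 h2
    match i, h1, h2 with
    | 0, h1, h2 =>
      have h1 : 1 + dmin ≤ u := EReal.coe_le_coe_iff.1 h1
      have h2 : u < 2 + dmin := EReal.coe_lt_coe_iff.1 h2
      simp [singleTrain, h1.not_gt, h2]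
    | _ + 1, h1, _ => exact absurd (EReal.coe_lt_top u) h1.not_gt
  gap := by
    intro i a b ha hb
    match i, ha, hb with
    | 0, ha, hb =>
      have ha : 1 = a := EReal.coe_eq_coe_iff.1 ha
      have hb : 1 + dmin = b := EReal.coe_eq_coe_iff.1 hb
      constructor <;> linarith
    | _ + 1, ha, _ => exact absurd ha.symm (EReal.coe_ne_top a)

/-- A run with a single train, in which the gate opens `h` units of time after the train leaves
the crossing. -/
noncomputable def singleTrainRun {dmin dmax dopen dclose h : ℝ} (hdmin : 0 < dmin)
    (hdclose : 0 < dclose) (hcm : dclose < dmin) (hmm : dmin ≤ dmax) (hh0 : 0 < h)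
    (hh : h < dopen) : RegularRun Unit dmin dmax dopen dclose where
  trackStatus _ := singleTrain dmin
  deadline _ := pulse 1 (2 + dmin) ((1 + (dmin - dclose) : ℝ) : EReal) ⊤
  dir := pulse (1 + (dmin - dclose)) (2 + dmin) .cls .opn
  gate := pulse (1 + (dmin - dclose) + dclose / 2) (2 + dmin + h) .closed .opened
  deadlinePlus _ := pulsePlus 1 (2 + dmin) ((1 + (dmin - dclose) : ℝ) : EReal) ⊤
  dirPlus := pulsePlus (1 + (dmin - dclose)) (2 + dmin) .cls .opn
  gatePlus := pulsePlus (1 + (dmin - dclose) + dclose / 2) (2 + dmin + h) .closed .opened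
  pwc_ts _ := pwc_singleTrain hdmin
  pwc_dl _ := pwc_pulse one_pos (by linarith) _ _
  pwc_dir := pwc_pulse (by linarith) (by linarith) _ _
  pwc_gate := pwc_pulse (by linarith) (by linarith) _ _
  dlPlus_spec _ t _ := rightVal_pulse _ _ _ _ t
  dirPlus_spec t _ := rightVal_pulse _ _ _ _ t
  gatePlus_spec t _ := rightVal_pulse _ _ _ _ t
  dl_left _ _ ht := leftVal_pulse _ _ _ _ ht
  dir_left _ ht := leftVal_pulse _ _ _ _ ht
  gate_left _ ht := leftVal_pulse _ _ _ _ ht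
  trainMotion _ := ⟨_, trainMotion_singleTrain hdmin hmm⟩
  dl_init _ := if_neg fun h => by linarith [h.1]
  dir_init := if_neg fun h => by linarith [h.1]
  gate_init := if_neg fun h => by linarith [h.1]
  dl_step_coming := by
    intro _ t _ hs hd
    have ht : t = 1 := by
      unfold singleTrain at hs
      unfold pulse at hd
      split_ifs at hs hd <;> first | exact absurd hd (EReal.coe_ne_top _) | grind
    rw [pulsePlus, if_pos ⟨ht.ge, by linarith⟩, ht]
  dl_step_empty := by
    intro _ t _ hs hd
    unfold singleTrain at hs
    unfold pulse at hd
    unfold pulsePlus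
    grind
  dl_step_other := by
    intro _ t _ h1 h2
    have hne := EReal.coe_ne_top (1 + (dmin - dclose))
    unfold singleTrain pulse at h1 h2
    unfold pulse pulsePlus
    grind
  dir_step_close := by
    rintro t _ ⟨_, hx⟩
    unfold pulse at hx
    split_ifs at hx
    · rw [EReal.coe_eq_coe_iff] at hx
      exact if_pos ⟨by linarith, by linarith⟩
    · exact absurd hx.symm (EReal.coe_ne_top t)
  dir_step_open := by
    intro t _ hne hd hs
    rcases hs () with hs | hs
    · unfold singleTrain at hs
      unfold pulse at hd
      unfold pulsePlus
      grind
    · have ht : 1 + (dmin - dclose) < t ∧ t ≤ 2 + dmin := by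
        unfold pulse at hd
        grind
      change _ < pulse _ _ _ _ t at hs
      rw [pulse, if_pos ⟨by linarith, ht.2⟩, EReal.coe_lt_coe_iff] at hs
      linarith
  dir_step_other := by
    intro t _ hne hns
    have h1 : t ≠ 1 + (dmin - dclose) := by
      rintro rfl
      exact hne () (if_pos ⟨by linarith, by linarith⟩)
    have h2 : t ≠ 2 + dmin := by
      rintro rfl
      exact hns ⟨if_pos ⟨by linarith, le_rfl⟩, fun _ => Or.inl (if_neg (lt_irrefl _))⟩
    unfold pulse pulsePlus
    grind
  gate_step := by
    intro t _
    unfold pulse pulsePlus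
    grind
  gate_close_bound := by
    intro t _ hall
    obtain ⟨h1, -⟩ := hall (t + dclose / 4) ⟨by linarith, by linarith⟩
    obtain ⟨h2, h3⟩ := hall (t + 7 * dclose / 8) ⟨by linarith, by linarith⟩
    unfold pulse at h1 h2 h3
    grind
  gate_open_bound := by
    intro t _ hall
    obtain ⟨u, hu, hu'⟩ : ∃ u, h < u ∧ u < dopen := exists_between hh
    obtain ⟨-, h1⟩ := hall (t + u) ⟨by linarith, by linarith⟩
    obtain ⟨h2, h3⟩ := hall (t + (u - h) / 2) ⟨by linarith, by linarith⟩
    unfold pulse at h1 h2 h3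
    grind

theorem optimality_claim_part1
    (dmin dmax dopen dclose : ℝ)
    (hdmin : 0 < dmin) (hdmax : 0 < dmax) (hdopen : 0 < dopen) (hdclose : 0 < dclose)
    (hcm : dclose < dmin) (hmm : dmin ≤ dmax)
    (c : ℝ) (hc0 : 0 < c) (hc : c < dopen) :
    ∃ R : RegularRun Unit dmin dmax dopen dclose, ∃ α β : ℝ,
      0 ≤ α ∧ α + c < β - (dclose + (dmax - dmin)) ∧
      (∀ t ∈ Set.Ioo α β, R.trackStatus () t ≠ TStat.incrossing) ∧
      ∃ t ∈ Set.Icc (α + c) (β - (dclose + (dmax - dmin))), R.gate t ≠ GateV.opened := by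
  obtain ⟨h, hch, hh⟩ := exists_between hc
  refine ⟨singleTrainRun hdmin hdclose hcm hmm (hc0.trans hch) hh, 2 + dmin,
    2 + dmin + c + (dclose + (dmax - dmin)) + 1, by linarith, by linarith, fun t ht => ?_,
    2 + dmin + c, ⟨le_rfl, by linarith⟩, ?_⟩
  · change singleTrain dmin t ≠ _
    simp [singleTrain, ht.1.not_gt]
  · have hg : pulse (1 + (dmin - dclose) + dclose / 2) (2 + dmin + h) GateV.closed .opened
        (2 + dmin + c) = .closed := if_pos ⟨by linarith, by linarith⟩
    change pulse _ _ _ _ _ ≠ _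
    simp [hg]

end RailCross
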